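/- Let Var and UnrSuff be finite sets each containing a wildcard element *, let K ∈ ℕ, and let G be a good set of named gaps over Var. Then the set of finite multisets over UnrSuff × G^K is well-quasi-ordered by the relation ∃∀≼ (even though for a general WQO base order this relation on multisets need not be a WQO). -/

import Mathlib

universe u v w

/-- A gap quadruple `(lw, ls, uw, us)` with `lw, ls ∈ ℕ` and `uw, us ∈ ℕ ∪ {∞}`. -/
structure GapVal where
  lw : ℕ
  ls : ℕ
  uw : ℕ∞
  us : ℕ∞

/-- Well-formedness of a gap quadruple: either both upper bounds are finite,
or both are `∞`. -/
def GapVal.WF (g : GapVal) : Prop :=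
  (g.uw ≠ ⊤ ∧ g.us ≠ ⊤) ∨ (g.uw = ⊤ ∧ g.us = ⊤)

/-- A named gap over `Var`: a variable together with either `nreg`
(modelled by `none`) or a gap quadruple. -/
abbrev NamedGap (Var : Type u) := Var × Option GapVal

/-- A gap quadruple is free if both its upper bounds are `∞`. -/
def GapVal.Free (g : GapVal) : Prop := g.uw = ⊤ ∧ g.us = ⊤

/-- A gap quadruple is `B`-gap-bounded if both its upper bounds are at most `B`. -/
def GapVal.Bounded (B : ℕ) (g : GapVal) : Prop := g.uw ≤ (B : ℕ∞) ∧ g.us ≤ (B : ℕ∞)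

/-- The order `⊴` on named gaps, where `star` is the wildcard element of `Var`. -/
def gapLe {Var : Type u} (star : Var) (a b : NamedGap Var) : Prop :=
  (a.1 ≠ b.1 → a.1 = star) ∧
  (a.2 = none ↔ b.2 = none) ∧
  ∀ v v' : GapVal, a.2 = some v → b.2 = some v' →
    v.lw ≤ v'.lw ∧ v.ls ≤ v'.ls ∧ v'.uw ≤ v.uw ∧ v'.us ≤ v.us

/-- A set of named gaps is `B`-good if each of its elements carrying a gap
quadruple is free or `B`-gap-bounded. -/
def GoodSet {Var : Type u} (B : ℕ) (G : Set (NamedGap Var)) : Prop :=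
  ∀ g ∈ G, ∀ v : GapVal, g.2 = some v → v.Free ∨ v.Bounded B

/-- `r` is a well-quasi-order on the subset `S`: every infinite sequence of
elements of `S` contains indices `i < j` with `r (f i) (f j)`. -/
def IsWQOOn {α : Type u} (S : Set α) (r : α → α → Prop) : Prop :=
  ∀ f : ℕ → α, (∀ n, f n ∈ S) → ∃ i j, i < j ∧ r (f i) (f j)

/-- A task state of dimension `K`. -/
abbrev TaskState (UnrSuff : Type u) (Var : Type v) (K : ℕ) :=
  UnrSuff × (Fin K → NamedGap Var)

/-- The order `≼` on task states, where `starU` and `star` are the wildcard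
elements of `UnrSuff` and `Var` respectively. -/
def taskLe {UnrSuff : Type u} {Var : Type v} (starU : UnrSuff) (star : Var) {K : ℕ}
    (a b : TaskState UnrSuff Var K) : Prop :=
  (a.1 ≠ b.1 → a.1 = starU) ∧ ∀ k, gapLe star (a.2 k) (b.2 k)

/-- `A ∀∃≼ B`: every element of `A` is `r`-below some element of `B`. -/
def forallExists {α : Type u} (r : α → α → Prop) (A B : Multiset α) : Prop :=
  ∀ a ∈ A, ∃ b ∈ B, r a b

/-- `A ∃∀≼ B`: every element of `B` is `r`-above some element of `A`. -/
def existsForall {α : Type u} (r : α → α → Prop) (A B : Multiset α) : Prop :=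
  ∀ b ∈ B, ∃ a ∈ A, r a b

/-- A configuration: finite sets of tasks and phasers (modelled as finite sets
of naturals), a Boolean valuation, control sequences, and phases.  In a phase
`(var, some (w, s))`, `w` is the wait value and `s` the signal value, while
`(var, none)` means the task is not registered to the phaser. -/
structure Config (BV : Type u) (Var : Type v) (UnrSuff : Type w) where
  T : Finset ℕ
  P : Finset ℕ
  bv : BV → Bool
  seq : ℕ → UnrSuff
  phase : ℕ → ℕ → Var × Option (ℕ × ℕ)

/-- A constraint: finite sets of tasks and phasers, a Boolean valuation with
wildcard (`none` is `*`), control sequences, named gaps, and environment gaps. -/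
structure Constraint (BV : Type u) (Var : Type v) (UnrSuff : Type w) where
  T : Finset ℕ
  P : Finset ℕ
  bv : BV → Option Bool
  seq : ℕ → UnrSuff
  gap : ℕ → ℕ → NamedGap Var
  egap : ℕ → ℕ × ℕ

/-- `c ⊨ φ`: the configuration `c` is denoted by the constraint `φ`.
The inequalities `lw ≤ l − w ≤ uw` and `ls ≤ s − l ≤ us` are rendered
additively (`w + lw ≤ l`, etc.) to avoid truncated subtraction issues. -/
def Denotes {BV : Type u} {Var : Type v} {UnrSuff : Type w} (star : Var) (starU : UnrSuff)
    (φ : Constraint BV Var UnrSuff) (c : Config BV Var UnrSuff) : Prop :=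
  (∀ b, φ.bv b ≠ some (c.bv b) → φ.bv b = none) ∧
  ∃ T1 ⊆ c.T, ∃ P1 ⊆ c.P, ∃ τ : ℕ → ℕ, ∃ π : ℕ → ℕ,
    T1.image τ = φ.T ∧ Set.InjOn π ↑P1 ∧ P1.image π = φ.P ∧
    (∀ t ∈ T1, φ.seq (τ t) ≠ c.seq t → φ.seq (τ t) = starU) ∧
    ∀ p ∈ P1, ∃ l : ℕ,
      (∀ t ∈ T1,
        ((c.phase t p).1 ≠ (φ.gap (τ t) (π p)).1 → (φ.gap (τ t) (π p)).1 = star) ∧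
        ((c.phase t p).2 = none ↔ (φ.gap (τ t) (π p)).2 = none) ∧
        (∀ w s : ℕ, ∀ v : GapVal, (c.phase t p).2 = some (w, s) →
          (φ.gap (τ t) (π p)).2 = some v →
          w + v.lw ≤ l ∧ ((l - w : ℕ) : ℕ∞) ≤ v.uw ∧
          l + v.ls ≤ s ∧ ((s - l : ℕ) : ℕ∞) ≤ v.us)) ∧
      (∀ t ∈ c.T, t ∉ T1 → ∀ w s : ℕ, (c.phase t p).2 = some (w, s) →
        w + (φ.egap (π p)).1 ≤ l ∧ l + (φ.egap (π p)).2 ≤ s)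

/-- The denotation `⟦φ⟧` of a constraint. -/
def Denotation {BV : Type u} {Var : Type v} {UnrSuff : Type w} (star : Var) (starU : UnrSuff)
    (φ : Constraint BV Var UnrSuff) : Set (Config BV Var UnrSuff) :=
  {c | Denotes star starU φ c}

/-- `φa ⊑ φb`: the constraint `φa` is entailed by the constraint `φb`. -/
def Entails {BV : Type u} {Var : Type v} {UnrSuff : Type w} (star : Var) (starU : UnrSuff)
    (φa φb : Constraint BV Var UnrSuff) : Prop :=
  (∀ b, φa.bv b ≠ φb.bv b → φa.bv b = none) ∧
  ∃ T1 ⊆ φb.T, ∃ P1 ⊆ φb.P, ∃ τ : ℕ → ℕ, ∃ π : ℕ → ℕ,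
    T1.image τ = φa.T ∧ Set.InjOn π ↑P1 ∧ P1.image π = φa.P ∧
    (∀ t ∈ T1, φa.seq (τ t) ≠ φb.seq t → φa.seq (τ t) = starU) ∧
    ∀ p ∈ P1,
      ((φa.egap (π p)).1 ≤ (φb.egap p).1 ∧ (φa.egap (π p)).2 ≤ (φb.egap p).2) ∧
      (∀ t ∈ T1, gapLe star (φa.gap (τ t) (π p)) (φb.gap t p)) ∧
      (∀ t ∈ φb.T, t ∉ T1 → ∀ v : GapVal, (φb.gap t p).2 = some v →
        (φa.egap (π p)).1 ≤ v.lw ∧ (φa.egap (π p)).2 ≤ v.ls)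

/-- A constraint is `B`-good if all the named gaps of its tasks/phasers
carrying a quadruple are free or `B`-gap-bounded. -/
def ConstraintBGood {BV : Type u} {Var : Type v} {UnrSuff : Type w} (B : ℕ)
    (φ : Constraint BV Var UnrSuff) : Prop :=
  ∀ t ∈ φ.T, ∀ p ∈ φ.P, ∀ v : GapVal, (φ.gap t p).2 = some v → v.Free ∨ v.Bounded B

/-- An encoding of a constraint: `L` task indices, `M` phaser indices. -/
structure Encoding (BV : Type u) (Var : Type v) (UnrSuff : Type w) where
  L : ℕ
  M : ℕ
  bv : BV → Option Bool
  acc : Fin L → UnrSuff × (Fin M → NamedGap Var)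
  env : Fin M → ℕ × ℕ

/-- `e` enumerates the finite set `S` (this corresponds to choosing a total
order on `S`, the element of index `i` being `e i`). -/
def IsEnum (S : Finset ℕ) (e : Fin S.card → ℕ) : Prop :=
  Function.Injective e ∧ ∀ i, e i ∈ S

/-- The encoding `⌈φ⌉` of a constraint `φ` with respect to enumerations
(total orders) `eT` of its tasks and `eP` of its phasers. -/
def encodingOf {BV : Type u} {Var : Type v} {UnrSuff : Type w}
    (φ : Constraint BV Var UnrSuff)
    (eT : Fin φ.T.card → ℕ) (eP : Fin φ.P.card → ℕ) : Encoding BV Var UnrSuff where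
  L := φ.T.card
  M := φ.P.card
  bv := φ.bv
  acc := fun i => (φ.seq (eT i), fun j => φ.gap (eT i) (eP j))
  env := fun j => φ.egap (eP j)

/-- The entailment relation `⊑ₑ` on encodings. -/
def EncEntails {BV : Type u} {Var : Type v} {UnrSuff : Type w} (star : Var) (starU : UnrSuff)
    (e e' : Encoding BV Var UnrSuff) : Prop :=
  (∀ b, e.bv b ≠ e'.bv b → e.bv b = none) ∧
  ∃ hM : e.M = e'.M, ∃ h : Fin e'.L → Fin e.L, Function.Surjective h ∧
    (∀ i : Fin e'.L,
      ((e.acc (h i)).1 ≠ (e'.acc i).1 → (e.acc (h i)).1 = starU) ∧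
      ∀ j : Fin e.M, gapLe star ((e.acc (h i)).2 j) ((e'.acc i).2 (Fin.cast hM j))) ∧
    (∀ j : Fin e.M, (e.env j).1 ≤ (e'.env (Fin.cast hM j)).1 ∧
      (e.env j).2 ≤ (e'.env (Fin.cast hM j)).2)

/-- An encoding is `B`-good if every named gap occurring in it and carrying a
quadruple is free or `B`-gap-bounded. -/
def EncodingBGood {BV : Type u} {Var : Type v} {UnrSuff : Type w} (B : ℕ)
    (e : Encoding BV Var UnrSuff) : Prop :=
  ∀ (i : Fin e.L) (j : Fin e.M) (v : GapVal),
    ((e.acc i).2 j).2 = some v → v.Free ∨ v.Bounded B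

/-- The complement of a finitely generated upper set of `ι → ℕ` is a finite union of boxes. -/
theorem exists_list_boxes_compl_upper {ι : Type*} [Finite ι] (A : Multiset (ι → ℕ)) :
    ∃ U : List (ι → ℕ∞), ∀ x : ι → ℕ,
      (∃ a ∈ A, a ≤ x) ↔ ¬ ∃ u ∈ U, ∀ k, (x k : ℕ∞) < u k := by
  classical
  have := Fintype.ofFinite ι
  induction A using Multiset.induction with
  | empty => exact ⟨[⊤], fun x => by simp⟩
  | cons a A ih =>
    obtain ⟨U, hU⟩ := ih
    refine ⟨U.flatMap fun u => Finset.univ.toList.map fun k =>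
      u ⊓ Function.update ⊤ k (a k : ℕ∞), fun x => ?_⟩
    have box (u : ι → ℕ∞) (k : ι) :
        (∀ l, (x l : ℕ∞) < (u ⊓ Function.update ⊤ k (a k : ℕ∞)) l) ↔
          (∀ l, (x l : ℕ∞) < u l) ∧ x k < a k := by
      simp only [Pi.inf_apply, lt_inf_iff, forall_and]
      refine and_congr_right fun _ => ⟨fun h => by simpa using h k, fun h l => ?_⟩
      obtain rfl | hl := eq_or_ne l k
      · simpa using h
      · simp [hl]
    simp only [Multiset.mem_cons, exists_eq_or_imp, hU, List.mem_flatMap, List.mem_map,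
      Finset.mem_toList, Finset.mem_univ, true_and]
    constructor
    · rintro h ⟨_, ⟨u, hu, k, rfl⟩, hx⟩
      rw [box] at hx
      rcases h with h | h
      · exact hx.2.not_ge (h k)
      · exact h ⟨u, hu, hx.1⟩
    · intro h
      by_contra! hcon
      obtain ⟨hax, u, hu, hx⟩ := hcon
      obtain ⟨k, hk⟩ : ∃ k, x k < a k := by simpa [Pi.le_def] using hax
      exact h ⟨_, ⟨u, hu, k, rfl⟩, (box u k).2 ⟨hx, hk⟩⟩

/-- Higman's lemma for a relation on a whole type. -/
theorem WellQuasiOrdered.sublistForall₂ {α : Type*} {r : α → α → Prop} [IsPreorder α r]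
    (h : WellQuasiOrdered r) : WellQuasiOrdered (List.SublistForall₂ r) := by
  have := Set.PartiallyWellOrderedOn.partiallyWellOrderedOn_sublistForall₂ r
    (Set.partiallyWellOrderedOn_univ_iff.2 h)
  simpa [Set.partiallyWellOrderedOn_univ_iff] using this

theorem List.SublistForall₂.exists_of_mem {α β : Type*} {r : α → β → Prop} {l : List α}
    {l' : List β} (h : List.SublistForall₂ r l l') : ∀ a ∈ l, ∃ b ∈ l', r a b := by
  induction h with
  | nil => simp
  | cons hab _ ih =>
    rintro a (_ | ⟨_, ha⟩)
    · exact ⟨_, by simp, hab⟩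
    · obtain ⟨b, hb, h⟩ := ih a ha
      exact ⟨b, by simp [hb], h⟩
  | cons_right _ ih =>
    intro a ha
    obtain ⟨b, hb, h⟩ := ih a ha
    exact ⟨b, by simp [hb], h⟩

/-- Finite multisets of finitely labelled vectors of naturals are well-quasi-ordered by
the domination order `existsForall`. -/
theorem wellQuasiOrdered_existsForall_label_vector (τ ι : Type*) [Finite τ] [Finite ι] :
    WellQuasiOrdered
      (existsForall fun a b : τ × (ι → ℕ) => a.1 = b.1 ∧ a.2 ≤ b.2) := by
  classical
  intro f
  choose U hU using fun (n : ℕ) (t : τ) =>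
    exists_list_boxes_compl_upper (((f n).filter fun a => a.1 = t).map Prod.snd)
  have hwqo : WellQuasiOrdered
      (List.SublistForall₂ (fun u v : ι → ℕ∞ => u ≤ v)) :=
    wellQuasiOrdered_le.sublistForall₂
  have : IsPreorder (List (ι → ℕ∞)) (List.SublistForall₂ fun u v : ι → ℕ∞ => u ≤ v) := {}
  obtain ⟨i, j, hij, h⟩ := WellQuasiOrdered.pi (ι := τ) (fun _ => hwqo) U
  refine ⟨i, j, hij, fun b hb => ?_⟩
  have hbj := (hU j b.1 b.2).1 ⟨b.2, Multiset.mem_map.2 ⟨b, by simp [hb], rfl⟩, le_rfl⟩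
  obtain ⟨a, ha, hab⟩ := (hU i b.1 b.2).2 fun ⟨u, hu, hx⟩ => by
    obtain ⟨v, hv, huv⟩ := (h b.1).exists_of_mem u hu
    exact hbj ⟨v, hv, fun k => (hx k).trans_le (huv k)⟩
  obtain ⟨c, hc, rfl⟩ := Multiset.mem_map.1 ha
  rw [Multiset.mem_filter] at hc
  exact ⟨c, hc.1, hc.2, hab⟩

/-- The upper bound `n` truncated at `B + 1`. -/
noncomputable def upperCode (B : ℕ) (n : ℕ∞) : Fin (B + 2) :=
  ⟨(min n ((B + 1 : ℕ) : ℕ∞)).toNat, by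
    have : (min n ((B + 1 : ℕ) : ℕ∞)).toNat ≤ B + 1 :=
      ENat.toNat_le_of_le_natCast (min_le_right _ _)
    omega⟩

theorem upperCode_injOn (B : ℕ) : Set.InjOn (upperCode B) {n | n = ⊤ ∨ n ≤ B} := by
  have key (n : ℕ) (hn : (n : ℕ∞) ≤ B) : (upperCode B n).val = n := by
    have h : n ≤ B := by exact_mod_cast hn
    have h' : (n : ℕ∞) ≤ ((B + 1 : ℕ) : ℕ∞) := by exact_mod_cast h.trans (Nat.le_succ B)
    simp only [upperCode]
    rw [min_eq_left h', ENat.toNat_natCast]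
  have key_top : (upperCode B ⊤).val = B + 1 := by
    simp only [upperCode]
    rw [min_eq_right le_top, ENat.toNat_natCast]
  intro m hm n hn h
  have hval := congrArg Fin.val h
  induction m using ENat.recTopCoe with
  | top =>
    induction n using ENat.recTopCoe with
    | top => rfl
    | coe n =>
      have hn : (n : ℕ∞) ≤ B := by simpa using hn
      rw [key_top, key n hn] at hval
      have : n ≤ B := by exact_mod_cast hn
      omega
  | coe m =>
    have hm : (m : ℕ∞) ≤ B := by simpa using hm
    induction n using ENat.recTopCoe with
    | top =>
      rw [key_top, key m hm] at hval
      have : m ≤ B := by exact_mod_cast hm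
      omega
    | coe n =>
      have hn : (n : ℕ∞) ≤ B := by simpa using hn
      rw [key m hm, key n hn] at hval
      rw [hval]

/-- The finite data of a named gap: its variable and its truncated upper bounds. -/
noncomputable def NamedGap.label {Var : Type*} (B : ℕ) (g : NamedGap Var) :
    Var × Option (Fin (B + 2) × Fin (B + 2)) :=
  (g.1, g.2.map fun v => (upperCode B v.uw, upperCode B v.us))

/-- The lower bounds of a named gap, both `0` for an unregistered one. -/
def NamedGap.lower {Var : Type*} (g : NamedGap Var) : Bool → ℕ :=
  fun c => g.2.elim 0 fun v => bif c then v.lw else v.ls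

theorem gapLe_of_label_eq {Var : Type*} (star : Var) {B : ℕ} {G : Set (NamedGap Var)}
    (hG : GoodSet B G) {a b : NamedGap Var} (ha : a ∈ G) (hb : b ∈ G)
    (hlabel : NamedGap.label B a = NamedGap.label B b)
    (hlower : NamedGap.lower a ≤ NamedGap.lower b) : gapLe star a b := by
  have mem (g : NamedGap Var) (hg : g ∈ G) (v : GapVal) (hv : g.2 = some v) :
      v.uw ∈ {n : ℕ∞ | n = ⊤ ∨ n ≤ B} ∧ v.us ∈ {n : ℕ∞ | n = ⊤ ∨ n ≤ B} :=
    (hG g hg v hv).elim (fun h => ⟨Or.inl h.1, Or.inl h.2⟩) fun h => ⟨Or.inr h.1, Or.inr h.2⟩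
  obtain ⟨hvar, hval⟩ := Prod.ext_iff.1 hlabel
  refine ⟨fun h => absurd hvar h, ?_, fun v v' hv hv' => ?_⟩
  · simpa [NamedGap.label] using congrArg (· = none) hval
  · have hcode : upperCode B v.uw = upperCode B v'.uw ∧ upperCode B v.us = upperCode B v'.us := by
      simpa [NamedGap.label, hv, hv'] using hval
    have hw := upperCode_injOn B (mem a ha v hv).1 (mem b hb v' hv').1 hcode.1
    have hs := upperCode_injOn B (mem a ha v hv).2 (mem b hb v' hv').2 hcode.2
    refine ⟨?_, ?_, hw.ge, hs.ge⟩
    · simpa [NamedGap.lower, hv, hv'] using hlower true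
    · simpa [NamedGap.lower, hv, hv'] using hlower false

/-- Finite multisets of task states over a good set of named gaps
are well-quasi-ordered by `∃∀≼`. -/
theorem multisets_isWQO_existsForall {Var : Type u} {UnrSuff : Type v}
    [Fintype Var] [Fintype UnrSuff] (star : Var) (starU : UnrSuff) (K : ℕ)
    (G : Set (NamedGap Var)) (hG : ∃ B : ℕ, GoodSet B G) :
    IsWQOOn {m : Multiset (TaskState UnrSuff Var K) | ∀ a ∈ m, ∀ k, a.2 k ∈ G}
      (existsForall (taskLe starU star)) := by
  obtain ⟨B, hB⟩ := hG
  intro f hf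
  let code (a : TaskState UnrSuff Var K) :
      (UnrSuff × (Fin K → Var × Option (Fin (B + 2) × Fin (B + 2)))) × (Fin K × Bool → ℕ) :=
    ((a.1, fun k => NamedGap.label B (a.2 k)), fun p => NamedGap.lower (a.2 p.1) p.2)
  obtain ⟨i, j, hij, h⟩ :=
    wellQuasiOrdered_existsForall_label_vector _ _ fun n => (f n).map code
  refine ⟨i, j, hij, fun b hb => ?_⟩
  obtain ⟨_, hmem, hlabel, hlower⟩ := h (code b) (Multiset.mem_map_of_mem code hb)
  obtain ⟨a, ha, rfl⟩ := Multiset.mem_map.1 hmem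
  obtain ⟨hseq, hgap⟩ := Prod.ext_iff.1 hlabel
  exact ⟨a, ha, fun hne => absurd hseq hne, fun k =>
    gapLe_of_label_eq star hB (hf i a ha k) (hf j b hb k) (congrFun hgap k)
      fun c => hlower (k, c)⟩
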